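/- arXiv:1402.3506 — 9 statements merged into one kernel-verified Lean document; each statement's English description precedes it below -/
import Mathlib

section
/- Let Γ be a nonempty set, B ⊆ (ℕ → Γ) a behavior, and l ≥ 1 an integer. Then (Γ, B^{l↑}) is an asynchronous l-complete approximation of (Γ, B); that is, B ⊆ B^{l↑} and (Γ, B^{l↑}) is asynchronously l-complete. -/
namespace LComplete

/-- The string `(γ s, γ (s+1), …, γ (s+len-1))`, i.e. the restriction `γ|[s, s+len-1]`. -/
def window {Γ : Type*} (γ : ℕ → Γ) (s len : ℕ) : List Γ :=
  (List.range len).map fun i => γ (s + i)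

/-- The set of restrictions `B|[s, s+len-1]` of all signals in the behavior `B`. -/
def windowSet {Γ : Type*} (B : Set (ℕ → Γ)) (s len : ℕ) : Set (List Γ) :=
  (fun γ => window γ s len) '' B

/-- `(Γ, B)` is asynchronously `m`-complete: a signal belongs to `B` iff its initial
string of length `m` is an initial string of `B` and every sliding window of length
`m+1` occurs somewhere in `B`. -/
def AsyncComplete {Γ : Type*} (m : ℕ) (B : Set (ℕ → Γ)) : Prop :=
  ∀ γ : ℕ → Γ,
    γ ∈ B ↔ (window γ 0 m ∈ windowSet B 0 m ∧
      ∀ k : ℕ, ∃ k' : ℕ, window γ k (m + 1) ∈ windowSet B k' (m + 1))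

/-- The behavior `B^{m↑}` of the strongest asynchronous `m`-complete approximation. -/
def lift {Γ : Type*} (m : ℕ) (B : Set (ℕ → Γ)) : Set (ℕ → Γ) :=
  { γ | window γ 0 m ∈ windowSet B 0 m ∧
      ∀ k : ℕ, ∃ k' : ℕ, window γ k (m + 1) ∈ windowSet B k' (m + 1) }

/-- The concatenation `w₁ ∧_{t₁}^{t₂} w₂`. -/
def concat {V : Type*} (w₁ w₂ : ℕ → V) (t₁ t₂ : ℕ) : ℕ → V :=
  fun t => if t < t₁ then w₁ t else w₂ (t - t₁ + t₂)

/-- `BS` is an asynchronous state space system. -/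
def IsAsyncSS {W X : Type*} (BS : Set ((ℕ → W) × (ℕ → X))) : Prop :=
  ∀ p ∈ BS, ∀ q ∈ BS, ∀ t₁ t₂ : ℕ, p.2 t₁ = q.2 t₂ →
    (concat p.1 q.1 t₁ t₂, concat p.2 q.2 t₁ t₂) ∈ BS

/-- State set `Z'` of the canonical state space system for `B'`. -/
def canonState {Γ : Type*} (l : ℕ) (B' : Set (ℕ → Γ)) : Set (List Γ) :=
  { ζ | (ζ.length < l ∧ ζ ∈ windowSet B' 0 ζ.length) ∨
        (ζ.length = l ∧ ∃ k : ℕ, ζ ∈ windowSet B' k l) }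

/-- Behavior `B'_S` of the canonical state space system for `B'`. -/
def canonBeh {Γ : Type*} (l : ℕ) (B' : Set (ℕ → Γ)) :
    Set ((ℕ → Γ) × (ℕ → List Γ)) :=
  { p | p.1 ∈ B' ∧
      ∀ k : ℕ, p.2 k = if k < l then window p.1 0 k else window p.1 (k - l) l }

/-- The external behavior of a state space behavior. -/
def extBeh {Γ X : Type*} (BS : Set ((ℕ → Γ) × (ℕ → X))) : Set (ℕ → Γ) :=
  { γ | ∃ x : ℕ → X, (γ, x) ∈ BS }

/-- `R` is an `m`-initial simulation relation from the system with behavior `BS₁`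
to the system with behavior `BS₂`. -/
def InitSim {Γ X₁ X₂ : Type*} (m : ℕ) (BS₁ : Set ((ℕ → Γ) × (ℕ → X₁)))
    (BS₂ : Set ((ℕ → Γ) × (ℕ → X₂))) (R : Set (X₁ × X₂)) : Prop :=
  (∀ p ∈ BS₁, ∃ q ∈ BS₂, (p.2 m, q.2 m) ∈ R) ∧
  (∀ p ∈ BS₁, ∀ q' ∈ BS₂, ∀ t₁ t₂ : ℕ, (p.2 t₁, q'.2 t₂) ∈ R →
    ∃ q ∈ BS₂,
      q.1 = concat q'.1 p.1 t₂ t₁ ∧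
      (∀ t ≤ t₂, q.2 t = q'.2 t) ∧
      ∀ j : ℕ, 1 ≤ j → (p.2 (t₁ + j), q.2 (t₂ + j)) ∈ R)

/-- `R` is a synchronous simulation relation from the system with behavior `BS₁`
to the system with behavior `BS₂`. -/
def SyncSim {Γ X₁ X₂ : Type*} (BS₁ : Set ((ℕ → Γ) × (ℕ → X₁)))
    (BS₂ : Set ((ℕ → Γ) × (ℕ → X₂))) (R : Set (X₁ × X₂)) : Prop :=
  (∀ t : ℕ, ∀ p ∈ BS₁, ∃ q ∈ BS₂, (p.2 t, q.2 t) ∈ R) ∧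
  (∀ p ∈ BS₁, ∀ q' ∈ BS₂, ∀ t : ℕ, (p.2 t, q'.2 t) ∈ R →
    ∃ q ∈ BS₂,
      q.1 = concat q'.1 p.1 t t ∧
      (∀ s ≤ t, q.2 s = q'.2 s) ∧
      ∀ j : ℕ, 1 ≤ j → (p.2 (t + j), q.2 (t + j)) ∈ R)

/-- `X^{k,ζ}`: states reached at time `k` with recent past `ζ`. -/
def reachAt {Γ X : Type*} (BS : Set ((ℕ → Γ) × (ℕ → X))) (k : ℕ) (ζ : List Γ) :
    Set X :=
  { ξ | ∃ p ∈ BS, p.2 k = ξ ∧ window p.1 (k - ζ.length) ζ.length = ζ }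

/-- `X_ζ`: states compatible with recent past `ζ`. -/
def reach {Γ X : Type*} (BS : Set ((ℕ → Γ) × (ℕ → X))) (ζ : List Γ) : Set X :=
  { ξ | ∃ k : ℕ, ζ.length ≤ k ∧ ξ ∈ reachAt BS k ζ }

/-- The relation `R₀ ⊆ X × Z'`. -/
def R0 {Γ X : Type*} (l : ℕ) (BS : Set ((ℕ → Γ) × (ℕ → X))) (B : Set (ℕ → Γ)) :
    Set (X × List Γ) :=
  { p | p.2 ∈ canonState l (lift l B) ∧
      ((p.2.length < l ∧ p.1 ∈ reachAt BS p.2.length p.2) ∨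
       (p.2.length = l ∧ p.1 ∈ reach BS p.2)) }

/-- The relation `R_l ⊆ X × Z'`. -/
def Rl {Γ X : Type*} (l : ℕ) (BS : Set ((ℕ → Γ) × (ℕ → X))) (B : Set (ℕ → Γ)) :
    Set (X × List Γ) :=
  { p | p.2 ∈ canonState l (lift l B) ∧ p.2.length = l ∧ p.1 ∈ reach BS p.2 }

/-- The relation `R_X ⊆ X × X`. -/
def RX {Γ X : Type*} (l : ℕ) (BS : Set ((ℕ → Γ) × (ℕ → X))) : Set (X × X) :=
  { p | ∃ ζ : List Γ, ζ.length = l ∧ p.1 ∈ reach BS ζ ∧ p.2 ∈ reach BS ζ }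

/-- The inverse of a relation. -/
def inv {X₁ X₂ : Type*} (R : Set (X₁ × X₂)) : Set (X₂ × X₁) :=
  { p | (p.2, p.1) ∈ R }

/-- The full behavior `B_f(P)` of a state machine `P = (X, W, δ, X₀)`. -/
def fullBeh {W X : Type*} (δ : Set (X × W × X)) (X₀ : Set X) :
    Set ((ℕ → W) × (ℕ → X)) :=
  { p | p.2 0 ∈ X₀ ∧ ∀ t : ℕ, (p.2 t, p.1 t, p.2 (t + 1)) ∈ δ }

/-- The transition relation `δ` of the canonical realization of `B'`. -/
def canonDelta {Γ : Type*} (l : ℕ) (B' : Set (ℕ → Γ)) :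
    Set (List Γ × Γ × List Γ) :=
  { t | (t.1.length < l ∧ t.2.2 = t.1 ++ [t.2.1] ∧
          t.1 ++ [t.2.1] ∈ windowSet B' 0 (t.1.length + 1)) ∨
        (t.1.length = l ∧ t.2.2 = t.1.tail ++ [t.2.1] ∧
          ∃ k' : ℕ, t.1 ++ [t.2.1] ∈ windowSet B' k' (l + 1)) }

end LComplete

namespace LComplete

/-- Every behavior is contained in its lift. -/
theorem subset_lift {Γ : Type*} (m : ℕ) (B : Set (ℕ → Γ)) : B ⊆ lift m B :=
  fun γ hγ => ⟨⟨γ, hγ, rfl⟩, fun k => ⟨k, γ, hγ, rfl⟩⟩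

/-- Lifting twice adds no further signals. -/
theorem lift_lift_subset {Γ : Type*} (m : ℕ) (B : Set (ℕ → Γ)) :
    lift m (lift m B) ⊆ lift m B := by
  rintro γ ⟨⟨β, hβ, hw⟩, hk⟩
  refine ⟨hw ▸ hβ.1, fun k => ?_⟩
  obtain ⟨k', α, hα, hw'⟩ := hk k
  exact hw' ▸ hα.2 k'

end LComplete

/-- `(Γ, B^{l↑})` is an asynchronous `l`-complete approximation of `(Γ, B)`:
`B ⊆ B^{l↑}` and `(Γ, B^{l↑})` is asynchronously `l`-complete. -/
theorem lift_isApprox {Γ : Type*} [Nonempty Γ] (B : Set (ℕ → Γ)) (l : ℕ) (hl : 1 ≤ l) :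
    B ⊆ LComplete.lift l B ∧ LComplete.AsyncComplete l (LComplete.lift l B) :=
  ⟨LComplete.subset_lift l B, fun _ =>
    ⟨fun h => LComplete.subset_lift l _ h, fun h => LComplete.lift_lift_subset l B h⟩⟩
end

section
/- Let Γ be a nonempty set, B ⊆ (ℕ → Γ) a behavior, and l ≥ 1 an integer. The strongest asynchronous l-complete approximation is unique: if (Γ, B') is an asynchronous l-complete approximation of (Γ, B) such that B' ⊆ B'' for every asynchronous l-complete approximation (Γ, B'') of (Γ, B), then B' = B^{l↑}. -/
namespace LComplete

theorem windowSet_mono {Γ : Type*} {B C : Set (ℕ → Γ)} (h : B ⊆ C) (s len : ℕ) :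
    windowSet B s len ⊆ windowSet C s len :=
  Set.image_mono h

theorem lift_mono {Γ : Type*} (m : ℕ) {B C : Set (ℕ → Γ)} (h : B ⊆ C) :
    lift m B ⊆ lift m C :=
  fun _ hγ => ⟨windowSet_mono h _ _ hγ.1,
    fun k => (hγ.2 k).imp fun _ hk => windowSet_mono h _ _ hk⟩

theorem asyncComplete_iff {Γ : Type*} {m : ℕ} {B : Set (ℕ → Γ)} :
    AsyncComplete m B ↔ B = lift m B :=
  Set.ext_iff.symm

theorem lift_lift {Γ : Type*} (m : ℕ) (B : Set (ℕ → Γ)) : lift m (lift m B) = lift m B := by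
  refine Set.Subset.antisymm (fun γ hγ => ?_) (subset_lift m _)
  obtain ⟨⟨α, hα, h0⟩, h⟩ := hγ
  refine ⟨h0 ▸ hα.1, fun k => ?_⟩
  obtain ⟨k', β, hβ, hk⟩ := h k
  exact hk ▸ hβ.2 k'

end LComplete

/-- uniqueness of the strongest asynchronous `l`-complete approximation. -/
theorem lift_unique {Γ : Type*} [Nonempty Γ] (B : Set (ℕ → Γ)) (l : ℕ) (hl : 1 ≤ l)
    (B' : Set (ℕ → Γ)) (hcomp : LComplete.AsyncComplete l B') (hsub : B ⊆ B')
    (hstrong : ∀ B'' : Set (ℕ → Γ), LComplete.AsyncComplete l B'' → B ⊆ B'' → B' ⊆ B'') :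
    B' = LComplete.lift l B := by
  exact (hstrong _ (LComplete.asyncComplete_iff.2 (LComplete.lift_lift l B).symm)
    (LComplete.subset_lift l B)).antisymm
    ((LComplete.lift_mono l hsub).trans_eq (LComplete.asyncComplete_iff.1 hcomp).symm)
end

section
/- Let Γ be a nonempty set, B ⊆ (ℕ → Γ) a behavior, and l ≥ 1 an integer. Then B^{(l+1)↑} ⊆ B^{l↑}; that is, increasing the parameter l refines the strongest asynchronous l-complete approximation (in particular B ⊆ B^{(l+1)↑} ⊆ B^{l↑}, so the approximation accuracy can be adjusted through l). -/
theorem LComplete.window_eq_of_window_succ_eq {Γ : Type*} {γ γ' : ℕ → Γ} {s s' len : ℕ}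
    (h : window γ s (len + 1) = window γ' s' (len + 1)) :
    window γ s len = window γ' s' len := by
  simp only [window, List.range_succ, List.map_append] at h ⊢
  exact (List.append_inj h (by simp)).1

theorem LComplete.window_mem_windowSet_of_succ {Γ : Type*} {B : Set (ℕ → Γ)} {γ : ℕ → Γ}
    {s s' len : ℕ} (h : window γ s (len + 1) ∈ windowSet B s' (len + 1)) :
    window γ s len ∈ windowSet B s' len := by
  obtain ⟨β, hβ, hw⟩ := h
  exact ⟨β, hβ, window_eq_of_window_succ_eq hw⟩

/-- `B ⊆ B^{(l+1)↑} ⊆ B^{l↑}`: increasing `l` refines the approximation. -/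
theorem lift_mono {Γ : Type*} [Nonempty Γ] (B : Set (ℕ → Γ)) (l : ℕ) (hl : 1 ≤ l) :
    B ⊆ LComplete.lift (l + 1) B ∧ LComplete.lift (l + 1) B ⊆ LComplete.lift l B := by
  refine ⟨fun γ hγ => ⟨⟨γ, hγ, rfl⟩, fun k => ⟨k, γ, hγ, rfl⟩⟩, fun γ hγ => ?_⟩
  exact ⟨LComplete.window_mem_windowSet_of_succ hγ.1, fun k =>
    (hγ.2 k).imp fun _ h => LComplete.window_mem_windowSet_of_succ h⟩
end

section
/- Let Γ be a nonempty set, B ⊆ (ℕ → Γ) a behavior, and l ≥ 1 an integer. Then the strongest asynchronous l-complete approximation operator is idempotent: (B^{l↑})^{l↑} = B^{l↑}. -/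
/-- the strongest asynchronous `l`-complete approximation operator is
idempotent: `(B^{l↑})^{l↑} = B^{l↑}`. -/
theorem lift_idem {Γ : Type*} [Nonempty Γ] (B : Set (ℕ → Γ)) (l : ℕ) (hl : 1 ≤ l) :
    LComplete.lift l (LComplete.lift l B) = LComplete.lift l B := by
  have subset_lift (m : ℕ) (B : Set (ℕ → Γ)) : B ⊆ LComplete.lift m B :=
    fun γ h => ⟨⟨γ, h, rfl⟩, fun k => ⟨k, γ, h, rfl⟩⟩
  refine Set.Subset.antisymm ?_ (subset_lift l _)
  rintro γ ⟨⟨β, hβ, hβγ⟩, h⟩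
  refine ⟨hβγ ▸ hβ.1, fun k => ?_⟩
  obtain ⟨k', α, hα, hαγ⟩ := h k
  exact hαγ ▸ hα.2 k'
end

section
/- Let Γ be a nonempty set, l ≥ 1 an integer, and suppose (Γ, B) is asynchronously l-complete. If γ₁, γ₂ ∈ B and k₁, k₂ ∈ ℕ satisfy k₁ ≥ l, k₂ ≥ l and γ₁|[k₁−l, k₁−1] = γ₂|[k₂−l, k₂−1] (equality of the length-l strings of most recent past values), then the concatenated signal γ₁ ∧_{k₁}^{k₂} γ₂ again belongs to B. -/
/-- Two windows of equal length agree iff they agree entrywise. -/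
theorem LComplete.window_eq_window_iff {Γ : Type*} {γ γ' : ℕ → Γ} {s s' len : ℕ} :
    LComplete.window γ s len = LComplete.window γ' s' len ↔
      ∀ i < len, γ (s + i) = γ' (s' + i) := by
  simp [LComplete.window, List.map_inj_left]

/-- in an asynchronously `l`-complete system, signals with identical
length-`l` recent pasts can be asynchronously concatenated within `B`. -/
theorem asyncComplete_concat {Γ : Type*} [Nonempty Γ] (l : ℕ) (hl : 1 ≤ l)
    (B : Set (ℕ → Γ)) (hB : LComplete.AsyncComplete l B)
    (γ₁ γ₂ : ℕ → Γ) (h₁ : γ₁ ∈ B) (h₂ : γ₂ ∈ B)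
    (k₁ k₂ : ℕ) (hk₁ : l ≤ k₁) (hk₂ : l ≤ k₂)
    (hpast : LComplete.window γ₁ (k₁ - l) l = LComplete.window γ₂ (k₂ - l) l) :
    LComplete.concat γ₁ γ₂ k₁ k₂ ∈ B := by
  have hpast' := LComplete.window_eq_window_iff.1 hpast
  refine (hB _).2 ⟨⟨γ₁, h₁, LComplete.window_eq_window_iff.2 fun i hi => ?_⟩, fun k => ?_⟩
  · simp [LComplete.concat, show i < k₁ by omega]
  · by_cases hk : k + l < k₁
    · refine ⟨k, γ₁, h₁, LComplete.window_eq_window_iff.2 fun i hi => ?_⟩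
      simp [LComplete.concat, show k + i < k₁ by omega]
    · refine ⟨k + k₂ - k₁, γ₂, h₂, LComplete.window_eq_window_iff.2 fun i hi => ?_⟩
      unfold LComplete.concat
      split_ifs with hki
      · have h := hpast' (k + i - (k₁ - l)) (by omega)
        rw [show k₁ - l + (k + i - (k₁ - l)) = k + i by omega,
          show k₂ - l + (k + i - (k₁ - l)) = k + k₂ - k₁ + i by omega] at h
        exact h.symm
      · congr 1
        omega
end

section
/- Let Γ be a nonempty set, l ≥ 1 an integer, and let B' ⊆ (ℕ → Γ) be such that (Γ, B') is asynchronously l-complete. Then the behavior B'_S of the canonical state space system for B' is an asynchronous state space system, and its projection onto the signal component equals B': { γ : (γ, z) ∈ B'_S for some z } = B'. -/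
namespace LComplete

theorem window_eq_window_iff_s8 {Γ : Type*} {γ γ' : ℕ → Γ} {s s' len : ℕ} :
    window γ s len = window γ' s' len ↔ ∀ i < len, γ (s + i) = γ' (s' + i) := by
  simp [window]

theorem length_window {Γ : Type*} (γ : ℕ → Γ) (s len : ℕ) : (window γ s len).length = len := by
  simp [window]

theorem concat_of_lt {V : Type*} (w₁ w₂ : ℕ → V) {t₁ t : ℕ} (t₂ : ℕ) (h : t < t₁) :
    concat w₁ w₂ t₁ t₂ t = w₁ t := if_pos h

theorem concat_of_le {V : Type*} (w₁ w₂ : ℕ → V) {t₁ t : ℕ} (t₂ : ℕ) (h : t₁ ≤ t) :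
    concat w₁ w₂ t₁ t₂ t = w₂ (t - t₁ + t₂) := if_neg h.not_gt

theorem concat_eq_right {V : Type*} {w₁ w₂ : ℕ → V} {t : ℕ} (h : ∀ s < t, w₁ s = w₂ s) :
    concat w₁ w₂ t t = w₂ := by
  funext s
  by_cases hs : s < t
  · rw [concat_of_lt w₁ w₂ t hs, h s hs]
  · rw [concat_of_le w₁ w₂ t (not_lt.1 hs), Nat.sub_add_cancel (not_lt.1 hs)]

/-- A window of a concatenation that ends before the junction. -/
theorem window_concat_left {V : Type*} (w₁ w₂ : ℕ → V) {t₁ s len : ℕ} (t₂ : ℕ)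
    (h : s + len ≤ t₁) : window (concat w₁ w₂ t₁ t₂) s len = window w₁ s len :=
  window_eq_window_iff_s8.2 fun _ hi => concat_of_lt w₁ w₂ t₂ (by omega)

/-- If the last `l` symbols before the junction agree, a window of a concatenation that starts at
most `l` steps before the junction is a window of the second signal. -/
theorem window_concat_right {V : Type*} {w₁ w₂ : ℕ → V} {l t₁ t₂ s s' : ℕ} (len : ℕ)
    (h₁ : l ≤ t₁) (h₂ : l ≤ t₂) (h : window w₁ (t₁ - l) l = window w₂ (t₂ - l) l)
    (hs : t₁ - l ≤ s) (hs' : s + t₂ = s' + t₁) :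
    window (concat w₁ w₂ t₁ t₂) s len = window w₂ s' len := by
  refine window_eq_window_iff_s8.2 fun i _ => ?_
  by_cases hi : s + i < t₁
  · rw [concat_of_lt w₁ w₂ t₂ hi]
    convert window_eq_window_iff_s8.1 h (s + i - (t₁ - l)) (by omega) using 2 <;> omega
  · rw [concat_of_le w₁ w₂ t₂ (not_lt.1 hi)]
    congr 1
    omega

theorem AsyncComplete.concat_mem {Γ : Type*} {l : ℕ} {B : Set (ℕ → Γ)} (hB : AsyncComplete l B)
    {w₁ w₂ : ℕ → Γ} (hw₁ : w₁ ∈ B) (hw₂ : w₂ ∈ B) {t₁ t₂ : ℕ} (h₁ : l ≤ t₁) (h₂ : l ≤ t₂)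
    (h : window w₁ (t₁ - l) l = window w₂ (t₂ - l) l) : concat w₁ w₂ t₁ t₂ ∈ B := by
  refine (hB _).2 ⟨⟨w₁, hw₁, (window_concat_left w₁ w₂ t₂ (by omega)).symm⟩, fun k => ?_⟩
  by_cases hk : k + (l + 1) ≤ t₁
  · exact ⟨k, w₁, hw₁, (window_concat_left w₁ w₂ t₂ hk).symm⟩
  · exact ⟨k + t₂ - t₁, w₂, hw₂,
      (window_concat_right (l + 1) h₁ h₂ h (by omega) (by omega)).symm⟩

theorem length_of_mem_canonBeh {Γ : Type*} {l : ℕ} {B : Set (ℕ → Γ)}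
    {p : (ℕ → Γ) × (ℕ → List Γ)} (hp : p ∈ canonBeh l B) (k : ℕ) :
    (p.2 k).length = min k l := by
  rw [hp.2 k]
  split_ifs <;> rw [length_window] <;> omega

theorem AsyncComplete.isAsyncSS_canonBeh {Γ : Type*} {l : ℕ} {B : Set (ℕ → Γ)}
    (hB : AsyncComplete l B) : IsAsyncSS (canonBeh l B) := by
  intro p hp q hq t₁ t₂ h
  have hlen : min t₁ l = min t₂ l := by
    rw [← length_of_mem_canonBeh hp, ← length_of_mem_canonBeh hq, h]
  by_cases h₁ : t₁ < l
  · obtain rfl : t₁ = t₂ := by omega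
    rw [hp.2, hq.2, if_pos h₁, if_pos h₁, window_eq_window_iff_s8] at h
    simp only [zero_add] at h
    rwa [concat_eq_right h, concat_eq_right fun s hs => ?_]
    rw [hp.2, hq.2, if_pos (hs.trans h₁), if_pos (hs.trans h₁), window_eq_window_iff_s8]
    intro i hi
    simpa using h i (hi.trans hs)
  · have h₂ : ¬ t₂ < l := by omega
    rw [hp.2, hq.2, if_neg h₁, if_neg h₂] at h
    rw [not_lt] at h₁ h₂
    refine ⟨hB.concat_mem hp.1 hq.1 h₁ h₂ h, fun k => ?_⟩
    by_cases hk : k < t₁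
    · dsimp only
      rw [concat_of_lt _ _ _ hk, hp.2]
      split_ifs <;> exact (window_concat_left _ _ _ (by omega)).symm
    · dsimp only
      rw [concat_of_le _ _ _ (not_lt.1 hk), hq.2, if_neg (by omega), if_neg (by omega)]
      exact (window_concat_right l h₁ h₂ h (by omega) (by omega)).symm

theorem extBeh_canonBeh {Γ : Type*} (l : ℕ) (B : Set (ℕ → Γ)) : extBeh (canonBeh l B) = B :=
  Set.ext fun γ => ⟨fun ⟨_, hx⟩ => hx.1, fun hγ =>
    ⟨fun k => if k < l then window γ 0 k else window γ (k - l) l, hγ, fun _ => rfl⟩⟩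

end LComplete

/-- the canonical state space system for an asynchronously `l`-complete
behavior `B'` is an asynchronous state space system whose projection onto the signal
component equals `B'`. -/
theorem canon_isAsyncSS {Γ : Type*} [Nonempty Γ] (l : ℕ) (hl : 1 ≤ l)
    (B' : Set (ℕ → Γ)) (hB' : LComplete.AsyncComplete l B') :
    LComplete.IsAsyncSS (LComplete.canonBeh l B') ∧
      LComplete.extBeh (LComplete.canonBeh l B') = B' := by
  exact ⟨hB'.isAsyncSS_canonBeh, LComplete.extBeh_canonBeh l B'⟩
end

section
/- Let Σ₁, Σ₂ be systems given by behaviors B_{S,1} of trajectories ℕ → Γ × X₁ and B_{S,2} of trajectories ℕ → Γ × X₂ over a common external signal space Γ. Every 0-initial simulation relation R ⊆ X₁ × X₂ from Σ₁ to Σ₂ is also a synchronous simulation relation from Σ₁ to Σ₂. -/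
/-- every `0`-initial simulation relation is also a synchronous
simulation relation. -/
theorem initSim_zero_syncSim {Γ X₁ X₂ : Type*}
    (BS₁ : Set ((ℕ → Γ) × (ℕ → X₁))) (BS₂ : Set ((ℕ → Γ) × (ℕ → X₂)))
    (R : Set (X₁ × X₂)) (h : LComplete.InitSim 0 BS₁ BS₂ R) :
    LComplete.SyncSim BS₁ BS₂ R := by
  obtain ⟨hinit, hstep⟩ := h
  refine ⟨fun t p hp => ?_, fun p hp q' hq' t hR => hstep p hp q' hq' t t hR⟩
  obtain ⟨q', hq', hR⟩ := hinit p hp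
  rcases t.eq_zero_or_pos with rfl | ht
  · exact ⟨q', hq', hR⟩
  · obtain ⟨q, hq, -, -, hj⟩ := hstep p hp q' hq' 0 0 hR
    exact ⟨q, hq, by simpa using hj t ht⟩
end

section
/- Let Σ₁, Σ₂ be systems given by behaviors B_{S,1} of trajectories ℕ → Γ × X₁ and B_{S,2} of trajectories ℕ → Γ × X₂ over a common external signal space Γ. If there exists a 0-initial simulation relation from Σ₁ to Σ₂, then the external behaviors are included in one another: { γ : (γ, x₁) ∈ B_{S,1} for some x₁ } ⊆ { γ : (γ, x₂) ∈ B_{S,2} for some x₂ }. -/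
/-- the existence of a `0`-initial simulation relation from `Σ₁` to `Σ₂`
implies inclusion of the external behaviors. -/
theorem initSim_zero_extBeh_subset {Γ X₁ X₂ : Type*}
    (BS₁ : Set ((ℕ → Γ) × (ℕ → X₁))) (BS₂ : Set ((ℕ → Γ) × (ℕ → X₂)))
    (h : ∃ R : Set (X₁ × X₂), LComplete.InitSim 0 BS₁ BS₂ R) :
    LComplete.extBeh BS₁ ⊆ LComplete.extBeh BS₂ := by
  obtain ⟨R, hinit, hstep⟩ := h
  rintro γ ⟨x, hx⟩
  obtain ⟨q', hq', hR⟩ := hinit _ hx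
  obtain ⟨q, hq, hγ, -, -⟩ := hstep _ hx q' hq' 0 0 hR
  have hconcat : LComplete.concat q'.1 γ 0 0 = γ := by
    funext t
    simp [LComplete.concat]
  exact ⟨q.2, (hγ.trans hconcat) ▸ hq⟩
end

section
/- Let Σ₁, Σ₂ be systems given by behaviors B_{S,1} of trajectories ℕ → Γ × X₁ and B_{S,2} of trajectories ℕ → Γ × X₂ over a common external signal space Γ. If there exists a relation R ⊆ X₁ × X₂ such that R is a 0-initial simulation relation from Σ₁ to Σ₂ and R^{-1} := { (b, a) : (a, b) ∈ R } is a 0-initial simulation relation from Σ₂ to Σ₁ (i.e., Σ₁ and Σ₂ are 0-initially bisimilar), then the external behaviors are equal: { γ : (γ, x₁) ∈ B_{S,1} for some x₁ } = { γ : (γ, x₂) ∈ B_{S,2} for some x₂ }. -/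
/-- A `0`-initial simulation relation yields inclusion of external behaviors. -/
theorem LComplete.InitSim.extBeh_subset {Γ X₁ X₂ : Type*}
    {BS₁ : Set ((ℕ → Γ) × (ℕ → X₁))} {BS₂ : Set ((ℕ → Γ) × (ℕ → X₂))}
    {R : Set (X₁ × X₂)} (h : LComplete.InitSim 0 BS₁ BS₂ R) :
    LComplete.extBeh BS₁ ⊆ LComplete.extBeh BS₂ := by
  rintro γ ⟨x, hx⟩
  obtain ⟨q', hq', hR⟩ := h.1 _ hx
  obtain ⟨⟨γ₂, x₂⟩, hq, hγ, -⟩ := h.2 _ hx q' hq' 0 0 hR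
  obtain rfl : γ₂ = γ := hγ.trans (by funext t; simp [LComplete.concat])
  exact ⟨x₂, hq⟩

/-- `0`-initial bisimilarity implies equality of external behaviors. -/
theorem initSim_zero_bisim_extBeh_eq {Γ X₁ X₂ : Type*}
    (BS₁ : Set ((ℕ → Γ) × (ℕ → X₁))) (BS₂ : Set ((ℕ → Γ) × (ℕ → X₂)))
    (h : ∃ R : Set (X₁ × X₂),
      LComplete.InitSim 0 BS₁ BS₂ R ∧ LComplete.InitSim 0 BS₂ BS₁ (LComplete.inv R)) :
    LComplete.extBeh BS₁ = LComplete.extBeh BS₂ := by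
  obtain ⟨R, h₁, h₂⟩ := h
  exact h₁.extBeh_subset.antisymm h₂.extBeh_subset
end
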